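/- In an atomic parallel-link congestion game with n ≥ 1 players, for any state S, the toll vector θ defined by θ_e = max(0, L(S) − l_e^+) implements S, and its set of tolled edges is exactly {e ∈ E : l_e^+ < L(S)}. -/

import Mathlib

/-!
Atomic parallel-link congestion game: finite nonempty edge set `E`, `n ≥ 1` players,
nonnegative monotone cost functions `c e : ℕ → ℝ`.  A state is `S : Fin n → E`.
-/

/-- Congestion of edge `e` in state `S`: the number of players using `e`. -/
def cong {E : Type*} [Fintype E] [DecidableEq E] {n : ℕ} (S : Fin n → E) (e : E) : ℕ :=
  (Finset.univ.filter fun i => S i = e).card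

/-- `L(S)`, the maximum player cost in state `S` (requires `n ≥ 1`). -/
def maxCost {E : Type*} [Fintype E] [DecidableEq E] (c : E → ℕ → ℝ) {n : ℕ}
    (hn : 1 ≤ n) (S : Fin n → E) : ℝ :=
  haveI : Nonempty (Fin n) := ⟨⟨0, hn⟩⟩
  Finset.univ.sup' Finset.univ_nonempty fun i => c (S i) (cong S (S i))

/-- The toll vector `θ` implements state `S`: `S` is a pure Nash equilibrium of
the tolled game. -/
def Implements {E : Type*} [Fintype E] [DecidableEq E] (c : E → ℕ → ℝ) {n : ℕ}
    (θ : E → ℝ) (S : Fin n → E) : Prop :=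
  ∀ i : Fin n, ∀ e : E, e ≠ S i →
    c (S i) (cong S (S i)) + θ (S i) ≤ c e (cong S e + 1) + θ e

/-- Every player's cost is at most the maximum player cost. -/
theorem le_maxCost {E : Type*} [Fintype E] [DecidableEq E] (c : E → ℕ → ℝ) {n : ℕ}
    (hn : 1 ≤ n) (S : Fin n → E) (i : Fin n) :
    c (S i) (cong S (S i)) ≤ maxCost c hn S :=
  Finset.le_sup' (fun i => c (S i) (cong S (S i))) (Finset.mem_univ i)

/-- In an atomic parallel-link congestion game with `n ≥ 1` players, for any state `S`,
the toll vector `θ_e = max(0, L(S) − l_e⁺)` implements `S`, and its set of tolled edges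
is exactly `{e : l_e⁺ < L(S)}`. -/
theorem parallelLink_canonical_tolls {E : Type*} [Fintype E] [DecidableEq E] [Nonempty E]
    (c : E → ℕ → ℝ) (hc : ∀ e k, 0 ≤ c e k) (hmono : ∀ e, Monotone (c e))
    {n : ℕ} (hn : 1 ≤ n) (S : Fin n → E) :
    Implements c (fun e => max 0 (maxCost c hn S - c e (cong S e + 1))) S ∧
    ∀ e : E, 0 < max 0 (maxCost c hn S - c e (cong S e + 1)) ↔
      c e (cong S e + 1) < maxCost c hn S := by
  refine ⟨fun i e _ => ?_, fun e => by simp⟩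
  have hL : c (S i) (cong S (S i)) ≤ maxCost c hn S := le_maxCost c hn S i
  have hm : c (S i) (cong S (S i)) ≤ c (S i) (cong S (S i) + 1) := hmono _ (Nat.le_succ _)
  have he := le_max_right 0 (maxCost c hn S - c e (cong S e + 1))
  have hi : max 0 (maxCost c hn S - c (S i) (cong S (S i) + 1)) ≤
      maxCost c hn S - c (S i) (cong S (S i)) := max_le (by linarith) (by linarith)
  dsimp only
  linarith
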